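/- Let α, β ∈ ℝ. Define on ℝ² (coordinates X, Y): R = X² − 8αX + Y² + 8βY; S = 3X⁴ − 44X³α + 6X²(Y² + 34α² + 10Yβ + 18β²) − 12Xα(5Y² + 24α² + 48Yβ + 88β²) + (3Y + 8β)(Y³ + 12Y²β + 256α²β + 36Y(α² + β²)); metric components g₁₁ = −(R/2)[9X⁴ + 10X²Y² + Y⁴ − 156αX³ − 76αXY² + 964X²α² + 132Y²α² − 2496Xα³ + 2304α⁴ + 4Y(3Y² + (5X − 24α)(3X − 8α))β + 4(9Y² + (3X − 8α)²)β²], g₁₂ = −4R(XY − 3αY + 3Xβ − 8αβ)((X − 6α)(X − 2α) + (Y + 2β)(Y + 6β)), g₂₂ = −(R/2)[X⁴ − 12X³α − 4Xα(3Y + 8β)(5Y + 24β) + 2X²(5Y² + 18α² + 38Yβ + 66β²) + (3Y + 8β)²(4α² + (Y + 6β)²)]; magnetic field Ω = −((X − 2α)(X − 6α) + (Y + 2β)(Y + 6β)); and F = (a₁₁P₁² + a₁₂P₁P₂ + a₂₂P₂² + b₁P₁ + b₂P₂ + c)/S², where a₁₁ = 16(XY − 3Yα + 3Xβ − 8αβ)²,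 a₂₂ = 4((3X − 8α)(X − 6α) + Y(Y + 6β))², a₁₂ = −16(XY − 3Yα + 3Xβ − 8αβ)((3X − 8α)(X − 6α) + Y(Y + 6β)), b₁ = 2S(−16Xαβ + X²(Y + 6β) − Y(Y + 6β)(3Y + 8β)), b₂ = S(−2(X − 6α)(3X² − Y² − 8Xα) − 32Yαβ), c = S²(X² + Y² − 4Xα + 12Yβ). Let H = (1/2)(g¹¹P₁² + 2g¹²P₁P₂ + g²²P₂²), where (gⁱʲ) is the inverse of the matrix (g_{ij}). Then at every point (X, Y, P₁, P₂) with S(X,Y) ≠ 0, g₁₁g₂₂ − g₁₂² ≠ 0, and H(X,Y,P₁,P₂) = 1/2, the magnetic Poisson bracket {F,H}_mg vanishes. -/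

import Mathlib

open Real

noncomputable section

/-- The magnetic Poisson bracket of two functions `F`, `H` of `(X, Y, P₁, P₂)` with
magnetic field `Ω(X,Y)`. -/
def magneticBracket (Ω : ℝ → ℝ → ℝ) (F H : ℝ → ℝ → ℝ → ℝ → ℝ)
    (X Y P₁ P₂ : ℝ) : ℝ :=
  deriv (fun t => F t Y P₁ P₂) X * deriv (fun t => H X Y t P₂) P₁
    - deriv (fun t => F X Y t P₂) P₁ * deriv (fun t => H t Y P₁ P₂) X
    + deriv (fun t => F X t P₁ P₂) Y * deriv (fun t => H X Y P₁ t) P₂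
    - deriv (fun t => F X Y P₁ t) P₂ * deriv (fun t => H X t P₁ P₂) Y
    + Ω X Y * (deriv (fun t => F X Y t P₂) P₁ * deriv (fun t => H X Y P₁ t) P₂
      - deriv (fun t => F X Y P₁ t) P₂ * deriv (fun t => H X Y t P₂) P₁)

def Rpoly (α β X Y : ℝ) : ℝ := X ^ 2 - 8 * α * X + Y ^ 2 + 8 * β * Y

def Spoly (α β X Y : ℝ) : ℝ :=
  3 * X ^ 4 - 44 * X ^ 3 * α
    + 6 * X ^ 2 * (Y ^ 2 + 34 * α ^ 2 + 10 * Y * β + 18 * β ^ 2)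
    - 12 * X * α * (5 * Y ^ 2 + 24 * α ^ 2 + 48 * Y * β + 88 * β ^ 2)
    + (3 * Y + 8 * β) *
      (Y ^ 3 + 12 * Y ^ 2 * β + 256 * α ^ 2 * β + 36 * Y * (α ^ 2 + β ^ 2))

def gc11 (α β X Y : ℝ) : ℝ :=
  -(Rpoly α β X Y / 2) *
    (9 * X ^ 4 + 10 * X ^ 2 * Y ^ 2 + Y ^ 4 - 156 * α * X ^ 3 - 76 * α * X * Y ^ 2
      + 964 * X ^ 2 * α ^ 2 + 132 * Y ^ 2 * α ^ 2 - 2496 * X * α ^ 3 + 2304 * α ^ 4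
      + 4 * Y * (3 * Y ^ 2 + (5 * X - 24 * α) * (3 * X - 8 * α)) * β
      + 4 * (9 * Y ^ 2 + (3 * X - 8 * α) ^ 2) * β ^ 2)

def gc12 (α β X Y : ℝ) : ℝ :=
  -4 * Rpoly α β X Y * (X * Y - 3 * α * Y + 3 * X * β - 8 * α * β) *
    ((X - 6 * α) * (X - 2 * α) + (Y + 2 * β) * (Y + 6 * β))

def gc22 (α β X Y : ℝ) : ℝ :=
  -(Rpoly α β X Y / 2) *
    (X ^ 4 - 12 * X ^ 3 * α - 4 * X * α * (3 * Y + 8 * β) * (5 * Y + 24 * β)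
      + 2 * X ^ 2 * (5 * Y ^ 2 + 18 * α ^ 2 + 38 * Y * β + 66 * β ^ 2)
      + (3 * Y + 8 * β) ^ 2 * (4 * α ^ 2 + (Y + 6 * β) ^ 2))

/-- The metric matrix `(g_{ij})`. -/
def gMatrix (α β X Y : ℝ) : Matrix (Fin 2) (Fin 2) ℝ :=
  !![gc11 α β X Y, gc12 α β X Y; gc12 α β X Y, gc22 α β X Y]

/-- The Hamiltonian `H = (1/2)(g¹¹P₁² + 2g¹²P₁P₂ + g²²P₂²)`, where `(gⁱʲ)` is the
inverse of the matrix `(g_{ij})`. -/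
def Hfun (α β X Y P₁ P₂ : ℝ) : ℝ :=
  (1 / 2) * ((gMatrix α β X Y)⁻¹ 0 0 * P₁ ^ 2
    + 2 * (gMatrix α β X Y)⁻¹ 0 1 * P₁ * P₂
    + (gMatrix α β X Y)⁻¹ 1 1 * P₂ ^ 2)

def Ωfun (α β X Y : ℝ) : ℝ :=
  -((X - 2 * α) * (X - 6 * α) + (Y + 2 * β) * (Y + 6 * β))

def Ffun (α β X Y P₁ P₂ : ℝ) : ℝ :=
  (16 * (X * Y - 3 * Y * α + 3 * X * β - 8 * α * β) ^ 2 * P₁ ^ 2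
    + (-16 * (X * Y - 3 * Y * α + 3 * X * β - 8 * α * β) *
        ((3 * X - 8 * α) * (X - 6 * α) + Y * (Y + 6 * β))) * P₁ * P₂
    + 4 * ((3 * X - 8 * α) * (X - 6 * α) + Y * (Y + 6 * β)) ^ 2 * P₂ ^ 2
    + 2 * Spoly α β X Y *
        (-(16 * X * α * β) + X ^ 2 * (Y + 6 * β) - Y * (Y + 6 * β) * (3 * Y + 8 * β)) * P₁
    + Spoly α β X Y *
        (-2 * (X - 6 * α) * (3 * X ^ 2 - Y ^ 2 - 8 * X * α) - 32 * Y * α * β) * P₂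
    + Spoly α β X Y ^ 2 * (X ^ 2 + Y ^ 2 - 4 * X * α + 12 * Y * β))
    / Spoly α β X Y ^ 2

/-- Half the common entry of the exact coframe defining the isothermal coordinates. -/
def coframeW (α β X Y : ℝ) : ℝ := X * Y - 3 * Y * α + 3 * X * β - 8 * α * β

/-- The coefficient of `dX` in the second form of the coframe. -/
def coframeV (α β X Y : ℝ) : ℝ := (3 * X - 8 * α) * (X - 6 * α) + Y * (Y + 6 * β)

/-- The coefficient of `dY` in the first form of the coframe, up to sign. -/
def coframeV' (α β X Y : ℝ) : ℝ := X * (X - 6 * α) + (Y + 6 * β) * (3 * Y + 8 * β)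

/-- The first momentum in isothermal coordinates. -/
def momU (α β X Y P₁ P₂ : ℝ) : ℝ :=
  (2 * coframeW α β X Y * P₁ - coframeV α β X Y * P₂) / Spoly α β X Y

/-- The second momentum in isothermal coordinates. -/
def momT (α β X Y P₁ P₂ : ℝ) : ℝ :=
  (coframeV' α β X Y * P₁ - 2 * coframeW α β X Y * P₂) / Spoly α β X Y

lemma Spoly_eq (α β X Y : ℝ) :
    Spoly α β X Y =
      coframeV α β X Y * coframeV' α β X Y - 4 * coframeW α β X Y ^ 2 := by
  unfold Spoly coframeV coframeV' coframeW; ring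

lemma gc11_eq (α β X Y : ℝ) :
    gc11 α β X Y =
      -(Rpoly α β X Y / 2) * (coframeV α β X Y ^ 2 + 4 * coframeW α β X Y ^ 2) := by
  unfold gc11 coframeV coframeW; ring

lemma gc22_eq (α β X Y : ℝ) :
    gc22 α β X Y =
      -(Rpoly α β X Y / 2) * (coframeV' α β X Y ^ 2 + 4 * coframeW α β X Y ^ 2) := by
  unfold gc22 coframeV' coframeW; ring

lemma gc12_eq (α β X Y : ℝ) :
    gc12 α β X Y =
      -Rpoly α β X Y * coframeW α β X Y * (coframeV α β X Y + coframeV' α β X Y) := by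
  unfold gc12 coframeV coframeV' coframeW; ring

lemma metric_det (α β X Y : ℝ) :
    gc11 α β X Y * gc22 α β X Y - gc12 α β X Y ^ 2 =
      (Rpoly α β X Y * Spoly α β X Y / 2) ^ 2 := by
  rw [gc11_eq, gc22_eq, gc12_eq, Spoly_eq]; ring

/-- In isothermal momenta the Hamiltonian is conformally flat. -/
lemma Hfun_eq (α β X Y P₁ P₂ : ℝ) :
    Hfun α β X Y P₁ P₂ =
      -(momU α β X Y P₁ P₂ ^ 2 + momT α β X Y P₁ P₂ ^ 2) / Rpoly α β X Y := by
  have hdet : (gMatrix α β X Y).det = (Rpoly α β X Y * Spoly α β X Y / 2) ^ 2 := by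
    rw [← metric_det, gMatrix, Matrix.det_fin_two_of]; ring
  have hinv : (gMatrix α β X Y)⁻¹ = ((Rpoly α β X Y * Spoly α β X Y / 2) ^ 2)⁻¹ •
      !![gc22 α β X Y, -gc12 α β X Y; -gc12 α β X Y, gc11 α β X Y] := by
    rw [Matrix.inv_def, hdet, Ring.inverse_eq_inv', gMatrix, Matrix.adjugate_fin_two_of]
  rw [Hfun, hinv]
  simp only [Matrix.smul_apply, Matrix.of_apply, Matrix.cons_val', Matrix.cons_val_zero,
    Matrix.cons_val_one, Matrix.cons_val_fin_one, smul_eq_mul]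
  rw [gc11_eq, gc22_eq, gc12_eq, momU, momT]
  generalize Spoly α β X Y = S
  rcases eq_or_ne (Rpoly α β X Y) 0 with hR | hR
  · simp [hR]
  rcases eq_or_ne S 0 with rfl | hS
  · simp
  field_simp
  ring

lemma Ffun_eq {α β X Y : ℝ} (P₁ P₂ : ℝ) (hS : Spoly α β X Y ≠ 0) :
    Ffun α β X Y P₁ P₂ =
      4 * momU α β X Y P₁ P₂ ^ 2 + 2 * X * momU α β X Y P₁ P₂ - 2 * Y * momT α β X Y P₁ P₂
        + (X ^ 2 + Y ^ 2 - 4 * X * α + 12 * Y * β) := by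
  rw [Ffun, momU, momT]
  generalize Spoly α β X Y = S at hS
  unfold coframeW coframeV coframeV'
  field_simp
  ring

/-- Derivative of the integral along a curve on which `u, t, x, y` are differentiable. -/
lemma hasDerivAt_integral {u t x y : ℝ → ℝ} {u' t' x' y' s : ℝ} (α β : ℝ)
    (hu : HasDerivAt u u' s) (ht : HasDerivAt t t' s)
    (hx : HasDerivAt x x' s) (hy : HasDerivAt y y' s) :
    HasDerivAt (fun r => 4 * u r ^ 2 + 2 * x r * u r - 2 * y r * t r
        + (x r ^ 2 + y r ^ 2 - 4 * x r * α + 12 * y r * β))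
      ((8 * u s + 2 * x s) * u' - 2 * y s * t' + (2 * u s + 2 * x s - 4 * α) * x'
        + (-2 * t s + 2 * y s + 12 * β) * y') s := by
  have h := ((((hu.pow 2).const_mul 4).add ((hx.const_mul 2).mul hu)).sub
    ((hy.const_mul 2).mul ht)).add
    ((((hx.pow 2).add (hy.pow 2)).sub ((hx.const_mul 4).mul_const α)).add
      ((hy.const_mul 12).mul_const β))
  refine (h.congr_deriv ?_).congr_of_eventuallyEq (.of_forall fun r => ?_)
  · simp; ring
  · simp

/-- Derivative of the Hamiltonian along a curve on which `u, t, R` are differentiable. -/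
lemma hasDerivAt_hamiltonian {u t R : ℝ → ℝ} {u' t' R' s : ℝ}
    (hu : HasDerivAt u u' s) (ht : HasDerivAt t t' s) (hR : HasDerivAt R R' s)
    (h0 : R s ≠ 0) :
    HasDerivAt (fun r => -(u r ^ 2 + t r ^ 2) / R r)
      (-2 * (u s * u' + t s * t') / R s + (u s ^ 2 + t s ^ 2) * R' / R s ^ 2) s := by
  refine ((((hu.pow 2).add (ht.pow 2)).neg.div hR h0).congr_deriv ?_).congr_of_eventuallyEq
    (.of_forall fun r => ?_)
  · simp; field_simp; ring
  · simp

section Curve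

variable {x y p q : ℝ → ℝ} {x' y' p' q' s : ℝ} (α β : ℝ)

lemma hasDerivAt_Rpoly (hx : HasDerivAt x x' s) (hy : HasDerivAt y y' s) :
    HasDerivAt (fun r => Rpoly α β (x r) (y r))
      ((2 * x s - 8 * α) * x' + (2 * y s + 8 * β) * y') s := by
  refine (((((hx.pow 2).sub (hx.const_mul (8 * α))).add (hy.pow 2)).add
    (hy.const_mul (8 * β))).congr_deriv ?_).congr_of_eventuallyEq (.of_forall fun r => ?_)
  · simp; ring
  · simp [Rpoly]

lemma hasDerivAt_coframeW (hx : HasDerivAt x x' s) (hy : HasDerivAt y y' s) :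
    HasDerivAt (fun r => coframeW α β (x r) (y r))
      ((y s + 3 * β) * x' + (x s - 3 * α) * y') s := by
  refine (((((hx.mul hy).sub (hy.const_mul (3 * α))).add (hx.const_mul (3 * β))).sub_const
    (8 * α * β)).congr_deriv ?_).congr_of_eventuallyEq (.of_forall fun r => ?_)
  · ring
  · simp [coframeW]; ring

lemma hasDerivAt_coframeV (hx : HasDerivAt x x' s) (hy : HasDerivAt y y' s) :
    HasDerivAt (fun r => coframeV α β (x r) (y r))
      ((6 * x s - 26 * α) * x' + (2 * y s + 6 * β) * y') s := by
  refine (((((hx.const_mul 3).sub_const (8 * α)).mul (hx.sub_const (6 * α))).add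
    (hy.mul (hy.add_const (6 * β)))).congr_deriv ?_).congr_of_eventuallyEq
    (.of_forall fun r => ?_)
  · ring
  · simp [coframeV]

lemma hasDerivAt_coframeV' (hx : HasDerivAt x x' s) (hy : HasDerivAt y y' s) :
    HasDerivAt (fun r => coframeV' α β (x r) (y r))
      ((2 * x s - 6 * α) * x' + (6 * y s + 26 * β) * y') s := by
  refine (((hx.mul (hx.sub_const (6 * α))).add ((hy.add_const (6 * β)).mul
    ((hy.const_mul 3).add_const (8 * β)))).congr_deriv ?_).congr_of_eventuallyEq
    (.of_forall fun r => ?_)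
  · ring
  · simp [coframeV']

/-- Coefficient of `dX` in the differential of `Spoly`. -/
def SpolyX (α β X Y : ℝ) : ℝ :=
  (6 * X - 26 * α) * coframeV' α β X Y + coframeV α β X Y * (2 * X - 6 * α)
    - 8 * coframeW α β X Y * (Y + 3 * β)

/-- Coefficient of `dY` in the differential of `Spoly`. -/
def SpolyY (α β X Y : ℝ) : ℝ :=
  (2 * Y + 6 * β) * coframeV' α β X Y + coframeV α β X Y * (6 * Y + 26 * β)
    - 8 * coframeW α β X Y * (X - 3 * α)

lemma hasDerivAt_Spoly (hx : HasDerivAt x x' s) (hy : HasDerivAt y y' s) :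
    HasDerivAt (fun r => Spoly α β (x r) (y r))
      (SpolyX α β (x s) (y s) * x' + SpolyY α β (x s) (y s) * y') s := by
  refine ((((hasDerivAt_coframeV α β hx hy).mul (hasDerivAt_coframeV' α β hx hy)).sub
    (((hasDerivAt_coframeW α β hx hy).pow 2).const_mul 4)).congr_deriv
    ?_).congr_of_eventuallyEq (.of_forall fun r => ?_)
  · simp [SpolyX, SpolyY]; ring
  · simp [Spoly_eq]

lemma hasDerivAt_momU (hx : HasDerivAt x x' s) (hy : HasDerivAt y y' s)
    (hp : HasDerivAt p p' s) (hq : HasDerivAt q q' s) (hS : Spoly α β (x s) (y s) ≠ 0) :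
    HasDerivAt (fun r => momU α β (x r) (y r) (p r) (q r))
      (((2 * (y s + 3 * β) * p s - (6 * x s - 26 * α) * q s
          - momU α β (x s) (y s) (p s) (q s) * SpolyX α β (x s) (y s)) * x'
        + (2 * (x s - 3 * α) * p s - (2 * y s + 6 * β) * q s
          - momU α β (x s) (y s) (p s) (q s) * SpolyY α β (x s) (y s)) * y'
        + 2 * coframeW α β (x s) (y s) * p' - coframeV α β (x s) (y s) * q')
        / Spoly α β (x s) (y s)) s := by
  refine ((((((hasDerivAt_coframeW α β hx hy).const_mul 2).mul hp).sub
    ((hasDerivAt_coframeV α β hx hy).mul hq)).div (hasDerivAt_Spoly α β hx hy) hS).congr_deriv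
    ?_).congr_of_eventuallyEq (.of_forall fun r => ?_)
  · simp [momU]; field_simp; ring
  · simp [momU]

lemma hasDerivAt_momT (hx : HasDerivAt x x' s) (hy : HasDerivAt y y' s)
    (hp : HasDerivAt p p' s) (hq : HasDerivAt q q' s) (hS : Spoly α β (x s) (y s) ≠ 0) :
    HasDerivAt (fun r => momT α β (x r) (y r) (p r) (q r))
      ((((2 * x s - 6 * α) * p s - 2 * (y s + 3 * β) * q s
          - momT α β (x s) (y s) (p s) (q s) * SpolyX α β (x s) (y s)) * x'
        + ((6 * y s + 26 * β) * p s - 2 * (x s - 3 * α) * q s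
          - momT α β (x s) (y s) (p s) (q s) * SpolyY α β (x s) (y s)) * y'
        + coframeV' α β (x s) (y s) * p' - 2 * coframeW α β (x s) (y s) * q')
        / Spoly α β (x s) (y s)) s := by
  refine (((((hasDerivAt_coframeV' α β hx hy).mul hp).sub
    (((hasDerivAt_coframeW α β hx hy).const_mul 2).mul hq)).div
    (hasDerivAt_Spoly α β hx hy) hS).congr_deriv
    ?_).congr_of_eventuallyEq (.of_forall fun r => ?_)
  · simp [momT]; field_simp; ring
  · simp [momT]

lemma deriv_Ffun {u' t' : ℝ} (hx : HasDerivAt x x' s) (hy : HasDerivAt y y' s)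
    (hS : Spoly α β (x s) (y s) ≠ 0)
    (hu : HasDerivAt (fun r => momU α β (x r) (y r) (p r) (q r)) u' s)
    (ht : HasDerivAt (fun r => momT α β (x r) (y r) (p r) (q r)) t' s) :
    deriv (fun r => Ffun α β (x r) (y r) (p r) (q r)) s =
      (8 * momU α β (x s) (y s) (p s) (q s) + 2 * x s) * u' - 2 * y s * t'
        + (2 * momU α β (x s) (y s) (p s) (q s) + 2 * x s - 4 * α) * x'
        + (-2 * momT α β (x s) (y s) (p s) (q s) + 2 * y s + 12 * β) * y' := by
  refine ((hasDerivAt_integral α β hu ht hx hy).congr_of_eventuallyEq ?_).deriv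
  filter_upwards [(hasDerivAt_Spoly α β hx hy).continuousAt.eventually_ne hS] with r hr
  exact Ffun_eq _ _ hr

lemma deriv_Hfun {u' t' : ℝ} (hx : HasDerivAt x x' s) (hy : HasDerivAt y y' s)
    (hR : Rpoly α β (x s) (y s) ≠ 0)
    (hu : HasDerivAt (fun r => momU α β (x r) (y r) (p r) (q r)) u' s)
    (ht : HasDerivAt (fun r => momT α β (x r) (y r) (p r) (q r)) t' s) :
    deriv (fun r => Hfun α β (x r) (y r) (p r) (q r)) s =
      -2 * (momU α β (x s) (y s) (p s) (q s) * u' + momT α β (x s) (y s) (p s) (q s) * t')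
          / Rpoly α β (x s) (y s)
        + (momU α β (x s) (y s) (p s) (q s) ^ 2 + momT α β (x s) (y s) (p s) (q s) ^ 2)
          * ((2 * x s - 8 * α) * x' + (2 * y s + 8 * β) * y') / Rpoly α β (x s) (y s) ^ 2 := by
  simp only [Hfun_eq]
  exact (hasDerivAt_hamiltonian hu ht (hasDerivAt_Rpoly α β hx hy) hR).deriv

end Curve

/-- Example 4 of the paper. The explicitly constructed metric and
magnetic field admit the quadratic integral `F` on the energy level `{H = 1/2}`:
the magnetic Poisson bracket `{F,H}_mg` vanishes at every point of this level set
where `S ≠ 0` and the metric is nondegenerate. -/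
theorem statement6 (α β : ℝ) :
    ∀ X Y P₁ P₂ : ℝ, Spoly α β X Y ≠ 0 →
      gc11 α β X Y * gc22 α β X Y - gc12 α β X Y ^ 2 ≠ 0 →
      Hfun α β X Y P₁ P₂ = 1 / 2 →
      magneticBracket (Ωfun α β) (Ffun α β) (Hfun α β) X Y P₁ P₂ = 0 := by
  intro X Y P₁ P₂ hS hdet hH
  have hR : Rpoly α β X Y ≠ 0 := by
    intro hR
    simp [metric_det, hR] at hdet
  have hX := hasDerivAt_id' X
  have hY := hasDerivAt_id' Y
  have hP := hasDerivAt_id' P₁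
  have hQ := hasDerivAt_id' P₂
  have c (a b : ℝ) : HasDerivAt (fun _ : ℝ => a) 0 b := hasDerivAt_const b a
  rw [magneticBracket,
    deriv_Ffun α β hX (c Y X) hS (hasDerivAt_momU α β hX (c Y X) (c P₁ X) (c P₂ X) hS)
      (hasDerivAt_momT α β hX (c Y X) (c P₁ X) (c P₂ X) hS),
    deriv_Hfun α β hX (c Y X) hR (hasDerivAt_momU α β hX (c Y X) (c P₁ X) (c P₂ X) hS)
      (hasDerivAt_momT α β hX (c Y X) (c P₁ X) (c P₂ X) hS),
    deriv_Ffun α β (c X Y) hY hS (hasDerivAt_momU α β (c X Y) hY (c P₁ Y) (c P₂ Y) hS)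
      (hasDerivAt_momT α β (c X Y) hY (c P₁ Y) (c P₂ Y) hS),
    deriv_Hfun α β (c X Y) hY hR (hasDerivAt_momU α β (c X Y) hY (c P₁ Y) (c P₂ Y) hS)
      (hasDerivAt_momT α β (c X Y) hY (c P₁ Y) (c P₂ Y) hS),
    deriv_Ffun α β (c X P₁) (c Y P₁) hS
      (hasDerivAt_momU α β (c X P₁) (c Y P₁) hP (c P₂ P₁) hS)
      (hasDerivAt_momT α β (c X P₁) (c Y P₁) hP (c P₂ P₁) hS),
    deriv_Hfun α β (c X P₁) (c Y P₁) hR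
      (hasDerivAt_momU α β (c X P₁) (c Y P₁) hP (c P₂ P₁) hS)
      (hasDerivAt_momT α β (c X P₁) (c Y P₁) hP (c P₂ P₁) hS),
    deriv_Ffun α β (c X P₂) (c Y P₂) hS
      (hasDerivAt_momU α β (c X P₂) (c Y P₂) (c P₁ P₂) hQ hS)
      (hasDerivAt_momT α β (c X P₂) (c Y P₂) (c P₁ P₂) hQ hS),
    deriv_Hfun α β (c X P₂) (c Y P₂) hR
      (hasDerivAt_momU α β (c X P₂) (c Y P₂) (c P₁ P₂) hQ hS)
      (hasDerivAt_momT α β (c X P₂) (c Y P₂) (c P₁ P₂) hQ hS)]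
  rw [Hfun_eq, div_eq_iff hR] at hH
  have hp : P₁ = coframeV α β X Y * momT α β X Y P₁ P₂
      - 2 * coframeW α β X Y * momU α β X Y P₁ P₂ := by
    rw [momU, momT]; field_simp; rw [Spoly_eq]; ring
  have hq : P₂ = 2 * coframeW α β X Y * momT α β X Y P₁ P₂
      - coframeV' α β X Y * momU α β X Y P₁ P₂ := by
    rw [momU, momT]; field_simp; rw [Spoly_eq]; ring
  generalize momU α β X Y P₁ P₂ = u at *
  generalize momT α β X Y P₁ P₂ = t at *
  have hsq : u ^ 2 + t ^ 2 = -(Rpoly α β X Y / 2) := by linarith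
  rw [hsq]
  subst hp hq
  simp only [mul_zero, add_zero, sub_zero, zero_add, mul_one, zero_sub]
  field_simp
  rw [Spoly_eq]
  set_option maxRecDepth 10000 in
  unfold SpolyX SpolyY Ωfun
  unfold Rpoly at hsq
  set_option maxRecDepth 10000 in
  unfold coframeW coframeV coframeV'
  set_option maxRecDepth 10000 in
  linear_combination (-16 * Rpoly α β X Y * (X * Y - 3 * Y * α + 3 * X * β - 8 * α * β)
    * (((3 * X - 8 * α) * (X - 6 * α) + Y * (Y + 6 * β))
        * (X * (X - 6 * α) + (Y + 6 * β) * (3 * Y + 8 * β))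
      - 4 * (X * Y - 3 * Y * α + 3 * X * β - 8 * α * β) ^ 2)) * hsq

end
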